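/- Let u, v, w be pairwise distinct points of ℝ² such that the first coordinates of u and v differ by at least 2ω₁, and the first coordinate of w differs from each of those of u and v by at least ω₁. Define the one-point-conditioned posterior covariance σ_{uv|w} := σ(u,v) − σ(u,w)·σ(w,v)/σ(w,w). Then |σ_{uv|w}| ≤ σ_s²·ξ⁴ + σ_s²·ξ²/ρ. -/

import Mathlib

open Real

/-- Squared exponential covariance function on ℝ². -/
noncomputable def seCov (σs σn ℓ₁ ℓ₂ : ℝ) (u v : ℝ × ℝ) : ℝ :=
  σs ^ 2 * Real.exp (-((u.1 - v.1) ^ 2) / (2 * ℓ₁ ^ 2) - (u.2 - v.2) ^ 2 / (2 * ℓ₂ ^ 2)) +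
    σn ^ 2 * (if u = v then 1 else 0)

theorem seCov_nonneg (σs σn ℓ₁ ℓ₂ : ℝ) (u v : ℝ × ℝ) : 0 ≤ seCov σs σn ℓ₁ ℓ₂ u v := by
  unfold seCov
  split_ifs <;> positivity

theorem seCov_self (σs σn ℓ₁ ℓ₂ : ℝ) (w : ℝ × ℝ) :
    seCov σs σn ℓ₁ ℓ₂ w w = σs ^ 2 + σn ^ 2 := by
  simp [seCov]

theorem seCov_comm (σs σn ℓ₁ ℓ₂ : ℝ) (u v : ℝ × ℝ) :
    seCov σs σn ℓ₁ ℓ₂ u v = seCov σs σn ℓ₁ ℓ₂ v u := by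
  simp only [seCov, sub_sq_comm u.1, sub_sq_comm u.2, eq_comm (a := u)]

/-- Horizontal separation at least `d` bounds the covariance of distinct points. -/
theorem seCov_le_of_le_abs_sub (σs σn ℓ₁ ℓ₂ : ℝ) {u v : ℝ × ℝ} {d : ℝ} (huv : u ≠ v)
    (hd : 0 ≤ d) (h : d ≤ |u.1 - v.1|) :
    seCov σs σn ℓ₁ ℓ₂ u v ≤ σs ^ 2 * Real.exp (-d ^ 2 / (2 * ℓ₁ ^ 2)) := by
  have hsq : d ^ 2 ≤ (u.1 - v.1) ^ 2 := by
    rw [← sq_abs (u.1 - v.1)]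
    gcongr
  have hvert : 0 ≤ (u.2 - v.2) ^ 2 / (2 * ℓ₂ ^ 2) := by positivity
  have hhor : -(u.1 - v.1) ^ 2 / (2 * ℓ₁ ^ 2) ≤ -d ^ 2 / (2 * ℓ₁ ^ 2) := by gcongr
  rw [seCov, if_neg huv, mul_zero, add_zero]
  gcongr
  linarith

theorem stmt_6 (σs σn ℓ₁ ℓ₂ ω₁ ξ ρ : ℝ)
    (hσs : 0 < σs) (hσn : 0 < σn) (hℓ₁ : 0 < ℓ₁) (hℓ₂ : 0 < ℓ₂) (hω₁ : 0 < ω₁)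
    (hξ : ξ = Real.exp (-ω₁ ^ 2 / (2 * ℓ₁ ^ 2)))
    (hρ : ρ = 1 + σn ^ 2 / σs ^ 2)
    (u v w : ℝ × ℝ) (huv : u ≠ v) (huw : u ≠ w) (hvw : v ≠ w)
    (hsepuv : 2 * ω₁ ≤ |u.1 - v.1|) (hsepuw : ω₁ ≤ |u.1 - w.1|) (hsepvw : ω₁ ≤ |v.1 - w.1|) :
    |seCov σs σn ℓ₁ ℓ₂ u v -
        seCov σs σn ℓ₁ ℓ₂ u w * seCov σs σn ℓ₁ ℓ₂ w v / seCov σs σn ℓ₁ ℓ₂ w w| ≤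
      σs ^ 2 * ξ ^ 4 + σs ^ 2 * ξ ^ 2 / ρ := by
  have hξ₄ : Real.exp (-(2 * ω₁) ^ 2 / (2 * ℓ₁ ^ 2)) = ξ ^ 4 := by
    rw [hξ, ← Real.exp_nat_mul]
    congr 1
    push_cast
    ring
  have hprior : seCov σs σn ℓ₁ ℓ₂ u v ≤ σs ^ 2 * ξ ^ 4 :=
    hξ₄ ▸ seCov_le_of_le_abs_sub σs σn ℓ₁ ℓ₂ huv (by positivity) hsepuv
  have hu : seCov σs σn ℓ₁ ℓ₂ u w ≤ σs ^ 2 * ξ :=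
    hξ ▸ seCov_le_of_le_abs_sub σs σn ℓ₁ ℓ₂ huw hω₁.le hsepuw
  have hv : seCov σs σn ℓ₁ ℓ₂ w v ≤ σs ^ 2 * ξ :=
    seCov_comm σs σn ℓ₁ ℓ₂ v w ▸ hξ ▸ seCov_le_of_le_abs_sub σs σn ℓ₁ ℓ₂ hvw hω₁.le hsepvw
  have hξ₀ : 0 ≤ ξ := hξ ▸ (Real.exp_pos _).le
  have hcorr : seCov σs σn ℓ₁ ℓ₂ u w * seCov σs σn ℓ₁ ℓ₂ w v / seCov σs σn ℓ₁ ℓ₂ w w ≤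
      σs ^ 2 * ξ ^ 2 / ρ := by
    calc _ ≤ (σs ^ 2 * ξ) * (σs ^ 2 * ξ) / (σs ^ 2 + σn ^ 2) := by
          rw [seCov_self]
          have := seCov_nonneg σs σn ℓ₁ ℓ₂ w v
          gcongr
      _ = σs ^ 2 * ξ ^ 2 / ρ := by
          rw [hρ]
          field_simp
  refine (abs_sub _ _).trans ?_
  rw [abs_of_nonneg (seCov_nonneg ..), abs_of_nonneg (div_nonneg
    (mul_nonneg (seCov_nonneg ..) (seCov_nonneg ..)) (seCov_nonneg ..))]
  exact add_le_add hprior hcorr
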